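/- Existence of a maximal equilibrium of the fair-exchange game: if every agent's benefit function b_i is continuous, nondecreasing, and concave on [0, ∞) and satisfies the vanishing-marginal-value condition, then there exists a nonnegative collection profile X* that is a pure Nash equilibrium and such that for every pure Nash equilibrium X' and every agent i, t_i(X') ≤ t_i(X*). -/

import Mathlib

open Finset

/-- Agent `i`'s total accessible data under fair exchange. -/
noncomputable def total {n : ℕ} (X : Fin n → ℝ) (i : Fin n) : ℝ :=
  X i + ∑ j ∈ univ.filter (fun j => j ≠ i), min (X i) (X j)

/-- Agent `i`'s utility. -/
noncomputable def U {n : ℕ} (b : Fin n → ℝ → ℝ) (c : Fin n → ℝ)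
    (X : Fin n → ℝ) (i : Fin n) : ℝ :=
  b i (total X i) - c i * X i

/-- `X` is a (nonnegative) pure Nash equilibrium of the fair-exchange game. -/
def IsNE {n : ℕ} (b : Fin n → ℝ → ℝ) (c : Fin n → ℝ) (X : Fin n → ℝ) : Prop :=
  (∀ i, 0 ≤ X i) ∧
    ∀ i, ∀ y, 0 ≤ y → U b c (Function.update X i y) i ≤ U b c X i

/-- weak count -/
noncomputable def cN {n : ℕ} (t : Fin n → ℝ) (i : Fin n) : ℝ :=
  1 + ∑ j ∈ univ.filter (fun j => j ≠ i), if t i ≤ t j then (1:ℝ) else 0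

/-- strict count -/
noncomputable def cM {n : ℕ} (t : Fin n → ℝ) (i : Fin n) : ℝ :=
  1 + ∑ j ∈ univ.filter (fun j => j ≠ i), if t i < t j then (1:ℝ) else 0

/-- left conditions -/
def setS {n : ℕ} (b : Fin n → ℝ → ℝ) (c : Fin n → ℝ) : Set (Fin n → ℝ) :=
  {t | (∀ i, 0 ≤ t i) ∧ ∀ i s, 0 ≤ s → s < t i → c i * (t i - s) ≤ (b i (t i) - b i s) * cN t i}

lemma cN_ge_one {n : ℕ} (t : Fin n → ℝ) (i : Fin n) : 1 ≤ cN t i := by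
  unfold cN
  have : 0 ≤ ∑ j ∈ univ.filter (fun j => j ≠ i), if t i ≤ t j then (1:ℝ) else 0 :=
    Finset.sum_nonneg (fun j _ => by split_ifs <;> norm_num)
  linarith

lemma cM_ge_one {n : ℕ} (t : Fin n → ℝ) (i : Fin n) : 1 ≤ cM t i := by
  unfold cM
  have : 0 ≤ ∑ j ∈ univ.filter (fun j => j ≠ i), if t i < t j then (1:ℝ) else 0 :=
    Finset.sum_nonneg (fun j _ => by split_ifs <;> norm_num)
  linarith

lemma cN_le {n : ℕ} (t : Fin n → ℝ) (i : Fin n) : cN t i ≤ 1 + n := by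
  unfold cN
  have h1 : ∑ j ∈ univ.filter (fun j => j ≠ i), (if t i ≤ t j then (1:ℝ) else 0)
      ≤ ∑ j ∈ univ.filter (fun j => j ≠ i), 1 :=
    Finset.sum_le_sum (fun j _ => by split_ifs <;> norm_num)
  have h2 : ∑ j ∈ univ.filter (fun j : Fin n => j ≠ i), (1:ℝ) ≤ ∑ j : Fin n, 1 :=
    Finset.sum_le_sum_of_subset_of_nonneg (Finset.filter_subset _ _) (fun _ _ _ => by norm_num)
  simp only [Finset.sum_const, Finset.card_univ, Fintype.card_fin, nsmul_eq_mul, mul_one] at h1 h2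
  linarith

lemma cN_mono {n : ℕ} (t t' : Fin n → ℝ) (i : Fin n)
    (h : ∀ j, j ≠ i → t i ≤ t j → t' i ≤ t' j) : cN t i ≤ cN t' i := by
  unfold cN
  gcongr with j hj
  have := h j (by simpa using hj)
  split_ifs <;> first | (exfalso; tauto) | norm_num

lemma total_eq {n : ℕ} (X : Fin n → ℝ) (i : Fin n) : total X i = ∑ j, min (X i) (X j) := by
  unfold total
  rw [Finset.filter_ne', ← Finset.add_sum_erase univ _ (Finset.mem_univ i), min_self]

lemma total_lt {n : ℕ} (X : Fin n → ℝ) (i j : Fin n) (h : X i < X j) : total X i < total X j := by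
  rw [total_eq, total_eq]
  apply Finset.sum_lt_sum
  · intro k _
    exact min_le_min_right _ h.le
  · exact ⟨j, Finset.mem_univ _, by rw [min_self, min_eq_left h.le]; exact h⟩

lemma total_lt_iff {n : ℕ} (X : Fin n → ℝ) (i j : Fin n) : total X i < total X j ↔ X i < X j := by
  refine ⟨fun h => ?_, total_lt X i j⟩
  by_contra hh
  rcases (not_lt.1 hh).lt_or_eq with h1 | h1
  · exact absurd (total_lt X j i h1) (not_lt.2 h.le)
  · rw [total_eq, total_eq, h1] at h
    exact lt_irrefl _ h

lemma total_le_iff {n : ℕ} (X : Fin n → ℝ) (i j : Fin n) : total X i ≤ total X j ↔ X i ≤ X j := by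
  rw [← not_lt, ← not_lt, total_lt_iff]

lemma cN_total {n : ℕ} (X : Fin n → ℝ) (i : Fin n) : cN (total X) i = cN X i := by
  simp only [cN, total_le_iff]

lemma cM_total {n : ℕ} (X : Fin n → ℝ) (i : Fin n) : cM (total X) i = cM X i := by
  simp only [cM, total_lt_iff]

lemma total_update {n : ℕ} (X : Fin n → ℝ) (i : Fin n) (y : ℝ) :
    total (Function.update X i y) i = y + ∑ j ∈ univ.filter (fun j => j ≠ i), min y (X j) := by
  unfold total
  rw [Function.update_self]
  congr 1
  apply Finset.sum_congr rfl
  intro j hj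
  rw [Function.update_of_ne (by simpa using hj)]

lemma total_nonneg {n : ℕ} (X : Fin n → ℝ) (h : ∀ i, 0 ≤ X i) (i : Fin n) : 0 ≤ total X i := by
  rw [total_eq]; exact Finset.sum_nonneg (fun j _ => le_min (h i) (h j))

lemma total_left {n : ℕ} (X : Fin n → ℝ) (i : Fin n) (y : ℝ) (hy : y ≤ X i) :
    (X i - y) * cN X i ≤ total X i - total (Function.update X i y) i := by
  rw [total_update]
  unfold total cN
  have : (X i - y) * (∑ j ∈ univ.filter (fun j => j ≠ i), if X i ≤ X j then (1:ℝ) else 0)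
      ≤ ∑ j ∈ univ.filter (fun j => j ≠ i), min (X i) (X j)
        - ∑ j ∈ univ.filter (fun j => j ≠ i), min y (X j) := by
    rw [Finset.mul_sum, ← Finset.sum_sub_distrib]
    apply Finset.sum_le_sum
    intro j _
    split_ifs with h
    · rw [min_eq_left h, min_eq_left (hy.trans h), mul_one]
    · have := min_le_min_right (X j) hy
      linarith
  linarith

lemma total_left_eq {n : ℕ} (X : Fin n → ℝ) (i : Fin n) (y : ℝ) (hy : y ≤ X i)
    (h' : ∀ j, X j < X i → X j ≤ y) :
    (X i - y) * cN X i = total X i - total (Function.update X i y) i := by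
  rw [total_update]
  unfold total cN
  have : (X i - y) * (∑ j ∈ univ.filter (fun j => j ≠ i), if X i ≤ X j then (1:ℝ) else 0)
      = ∑ j ∈ univ.filter (fun j => j ≠ i), min (X i) (X j)
        - ∑ j ∈ univ.filter (fun j => j ≠ i), min y (X j) := by
    rw [Finset.mul_sum, ← Finset.sum_sub_distrib]
    apply Finset.sum_congr rfl
    intro j _
    split_ifs with h
    · rw [min_eq_left h, min_eq_left (hy.trans h), mul_one]
    · rw [min_eq_right (not_le.1 h).le, min_eq_right (h' j (not_le.1 h))]
      ring
  linarith

lemma total_right {n : ℕ} (X : Fin n → ℝ) (i : Fin n) (y : ℝ) (hy : X i ≤ y) :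
    total (Function.update X i y) i - total X i ≤ (y - X i) * cM X i := by
  rw [total_update]
  unfold total cM
  have : ∑ j ∈ univ.filter (fun j => j ≠ i), min y (X j)
      - ∑ j ∈ univ.filter (fun j => j ≠ i), min (X i) (X j) ≤
      (y - X i) * (∑ j ∈ univ.filter (fun j => j ≠ i), if X i < X j then (1:ℝ) else 0) := by
    rw [Finset.mul_sum, ← Finset.sum_sub_distrib]
    apply Finset.sum_le_sum
    intro j _
    split_ifs with h
    · rw [min_eq_left h.le, mul_one]
      linarith [min_le_left y (X j)]
    · rw [min_eq_right (not_lt.1 h)]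
      linarith [min_le_right y (X j)]
  linarith

lemma exists_total {n : ℕ} (t : Fin n → ℝ) (ht : ∀ i, 0 ≤ t i) :
    ∃ X : Fin n → ℝ, (∀ i, 0 ≤ X i) ∧ ∀ i, total X i = t i := by
  have key : ∀ s : Finset (Fin n), ∃ X : Fin n → ℝ, (∀ i ∈ s, 0 ≤ X i) ∧
      ∀ i ∈ s, ∑ j ∈ s, min (X i) (X j) + ((n:ℝ) - s.card) * X i = t i := by
    intro s
    induction s using Finset.induction_on_max_value t with
    | empty => exact ⟨fun _ => 0, by simp, by simp⟩
    | insert a s ha hmax ih =>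
      obtain ⟨X, hX0, hX⟩ := ih
      have hcard : (s.card : ℝ) + 1 ≤ n := by
        have := Finset.card_le_univ (insert a s)
        rw [Finset.card_insert_of_notMem ha, Fintype.card_fin] at this
        exact_mod_cast this
      have hpos : 0 < (n:ℝ) - s.card := by linarith
      set x := (t a - ∑ j ∈ s, X j) / ((n:ℝ) - s.card) with hx
      have hx' : x * ((n:ℝ) - s.card) = t a - ∑ j ∈ s, X j := by
        rw [hx]; field_simp
      have hge : ∀ j ∈ s, X j ≤ x := by
        intro j hj
        obtain ⟨m, hm, hmm⟩ := Finset.exists_max_image s X ⟨j, hj⟩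
        refine (hmm j hj).trans ?_
        have h1 := hX m hm
        rw [Finset.sum_congr rfl (fun k hk => min_eq_right (hmm k hk))] at h1
        have h2 := hmax m hm
        by_contra hlt
        have := mul_lt_mul_of_pos_right (not_le.1 hlt) hpos
        linarith
      have hx0 : 0 ≤ x := by
        rcases s.eq_empty_or_nonempty with rfl | ⟨j, hj⟩
        · rw [hx]; apply div_nonneg _ hpos.le; simpa using ht a
        · exact (hX0 j hj).trans (hge j hj)
      have hne : ∀ j ∈ s, Function.update X a x j = X j := fun j hj =>
        Function.update_of_ne (ne_of_mem_of_not_mem hj ha) _ _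
      refine ⟨Function.update X a x, ?_, ?_⟩
      · intro i hi
        rcases Finset.mem_insert.1 hi with rfl | hi
        · simpa using hx0
        · rw [hne i hi]; exact hX0 i hi
      · intro i hi
        rw [Finset.sum_insert ha, Finset.card_insert_of_notMem ha, Function.update_self]
        push_cast
        rcases Finset.mem_insert.1 hi with rfl | hi
        · rw [Function.update_self, min_self,
            Finset.sum_congr rfl (fun k hk => by rw [hne k hk, min_eq_right (hge k hk)])]
          linarith
        · rw [hne i hi, min_eq_left (hge i hi),
            Finset.sum_congr rfl (fun k hk => by rw [hne k hk])]
          linarith [hX i hi]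
  obtain ⟨X, h0, h⟩ := key univ
  refine ⟨X, fun i => h0 i (mem_univ i), fun i => ?_⟩
  have := h i (mem_univ i)
  rw [total_eq]
  simpa using this

lemma ne_mem {n : ℕ} (b : Fin n → ℝ → ℝ) (c : Fin n → ℝ)
    (hbconc : ∀ i, ConcaveOn ℝ (Set.Ici 0) (b i)) (X : Fin n → ℝ) (h : IsNE b c X) :
    total X ∈ setS b c := by
  obtain ⟨h0, h⟩ := h
  refine ⟨total_nonneg X h0, fun i s hs hst => ?_⟩
  have hN := cN_ge_one X i
  have hXi : 0 < X i := by
    rcases (h0 i).lt_or_eq with h1 | h1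
    · exact h1
    · exfalso
      have : total X i = 0 := by
        rw [total_eq, ← h1]
        exact Finset.sum_eq_zero (fun j _ => min_eq_left (h0 j))
      linarith
  have hd : 0 < (total X i - s) / cN X i := div_pos (by linarith) (by linarith)
  -- choose y close to X i
  have hev : ∀ᶠ y in nhdsWithin (X i) (Set.Iio (X i)), y < X i ∧ 0 < y ∧
      X i - (total X i - s) / cN X i < y ∧ ∀ j, X j < X i → X j ≤ y := by
    refine eventually_mem_nhdsWithin.and (Filter.Eventually.filter_mono nhdsWithin_le_nhds ?_)
    refine (eventually_gt_nhds hXi).and ((eventually_gt_nhds (by linarith)).and ?_)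
    rw [Filter.eventually_all]
    intro j
    by_cases hj : X j < X i
    · filter_upwards [eventually_gt_nhds hj] with y hy _ using hy.le
    · exact Filter.Eventually.of_forall (fun y h => absurd h hj)
  obtain ⟨y, hy1, hy2, hy3, hy4⟩ := hev.exists
  have hT := total_left_eq X i y hy1.le hy4
  have hU := h i y hy2.le
  unfold U at hU
  rw [Function.update_self] at hU
  rw [cN_total]
  set T := total (Function.update X i y) i
  have hsT : s < T := by
    have : (X i - y) * cN X i < total X i - s := by
      rw [← lt_div_iff₀ (by linarith)]; linarith
    linarith
  have hTt : T < total X i := by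
    have : 0 < (X i - y) * cN X i := mul_pos (by linarith) (by linarith)
    linarith
  have hsl := (hbconc i).slope_anti_adjacent (Set.mem_Ici.2 hs)
    (Set.mem_Ici.2 (hs.trans hst.le)) hsT hTt
  rw [div_le_div_iff₀ (by linarith) (by linarith)] at hsl
  have e1 : c i * (total X i - T) ≤ (b i (total X i) - b i T) * cN X i := by
    rw [← hT]; nlinarith
  -- (bt - bT)(T - s) ≤ (bT - bs)(t - T)
  have e2 : (total X i - s) * (b i (total X i) - b i T) ≤
      (total X i - T) * (b i (total X i) - b i s) := by linarith
  have e3 : (c i * (total X i - s)) * (total X i - T)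
      ≤ ((b i (total X i) - b i s) * cN X i) * (total X i - T) := by
    calc _ = (total X i - s) * (c i * (total X i - T)) := by ring
      _ ≤ (total X i - s) * ((b i (total X i) - b i T) * cN X i) :=
        mul_le_mul_of_nonneg_left e1 (by linarith)
      _ = ((total X i - s) * (b i (total X i) - b i T)) * cN X i := by ring
      _ ≤ ((total X i - T) * (b i (total X i) - b i s)) * cN X i :=
        mul_le_mul_of_nonneg_right e2 (by linarith)
      _ = _ := by ring
  exact le_of_mul_le_mul_right e3 (by linarith)

lemma mem_ne {n : ℕ} (b : Fin n → ℝ → ℝ) (c : Fin n → ℝ) (hc : ∀ i, 0 < c i)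
    (X : Fin n → ℝ) (h0 : ∀ i, 0 ≤ X i) (hS : total X ∈ setS b c)
    (hR : ∀ i s, total X i < s →
      (b i s - b i (total X i)) * cM (total X) i ≤ c i * (s - total X i)) :
    IsNE b c X := by
  refine ⟨h0, fun i y hy => ?_⟩
  unfold U
  rw [Function.update_self]
  have hN := cN_ge_one X i
  have hM := cM_ge_one X i
  rcases lt_trichotomy y (X i) with hlt | rfl | hgt
  · have hT := total_left X i y hlt.le
    have hpos : 0 < (X i - y) * cN X i := mul_pos (by linarith) (by linarith)
    have hT0 : 0 ≤ total (Function.update X i y) i := by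
      rw [total_update]
      exact add_nonneg hy (Finset.sum_nonneg fun j _ => le_min hy (h0 j))
    have hL := hS.2 i _ hT0 (by linarith)
    rw [cN_total] at hL
    have := mul_le_mul_of_nonneg_left hT (hc i).le
    have h3 : (c i * (X i - y)) * cN X i ≤
      (b i (total X i) - b i (total (Function.update X i y) i)) * cN X i := by linarith
    have := le_of_mul_le_mul_right h3 (by linarith)
    linarith
  · rw [Function.update_eq_self]
  · have hT := total_right X i y hgt.le
    have hlt : total X i < total (Function.update X i y) i := by
      rw [total_update]
      unfold total
      have : ∑ j ∈ univ.filter (fun j => j ≠ i), min (X i) (X j) ≤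
        ∑ j ∈ univ.filter (fun j => j ≠ i), min y (X j) :=
        Finset.sum_le_sum fun j _ => min_le_min_right _ hgt.le
      linarith
    have hL := hR i _ hlt
    rw [cM_total] at hL
    have := mul_le_mul_of_nonneg_left hT (hc i).le
    have h3 : (b i (total (Function.update X i y) i) - b i (total X i)) * cM X i ≤
      (c i * (y - X i)) * cM X i := by linarith
    have := le_of_mul_le_mul_right h3 (by linarith)
    linarith

lemma setS_sup {n : ℕ} (b : Fin n → ℝ → ℝ) (c : Fin n → ℝ)
    (hbm : ∀ i, MonotoneOn (b i) (Set.Ici 0)) (t t' : Fin n → ℝ)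
    (h : t ∈ setS b c) (h' : t' ∈ setS b c) : t ⊔ t' ∈ setS b c := by
  have aux : ∀ t t' : Fin n → ℝ, t ∈ setS b c → ∀ i s, 0 ≤ s → (t ⊔ t') i = t i → s < t i →
      c i * (t i - s) ≤ (b i (t i) - b i s) * cN (t ⊔ t') i := by
    intro t t' h i s hs e hst
    refine (h.2 i s hs hst).trans (mul_le_mul_of_nonneg_left ?_ ?_)
    · apply cN_mono
      intro j _ hj
      rw [e]
      exact hj.trans le_sup_left
    · exact sub_nonneg.2 (hbm i hs (hs.trans hst.le) hst.le)
  refine ⟨fun i => (h.1 i).trans le_sup_left, fun i s hs hst => ?_⟩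
  rcases le_total (t i) (t' i) with hle | hle
  · have e : (t' ⊔ t) i = t' i := sup_eq_left.2 hle
    rw [sup_comm] at hst ⊢
    rw [e] at hst ⊢
    exact aux t' t h' i s hs e hst
  · have e : (t ⊔ t') i = t i := sup_eq_left.2 hle
    rw [e] at hst ⊢
    exact aux t t' h i s hs e hst

lemma setS_closed {n : ℕ} (b : Fin n → ℝ → ℝ) (c : Fin n → ℝ)
    (hbc : ∀ i, ContinuousOn (b i) (Set.Ici 0))
    (hbm : ∀ i, MonotoneOn (b i) (Set.Ici 0)) : IsClosed (setS b c) := by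
  apply isClosed_of_closure_subset
  intro t ht
  obtain ⟨u, hu, hut⟩ := mem_closure_iff_seq_limit.1 ht
  have hui : ∀ i, Filter.Tendsto (fun k => u k i) Filter.atTop (nhds (t i)) :=
    fun i => (tendsto_pi_nhds.1 hut) i
  refine ⟨fun i => ge_of_tendsto' (hui i) (fun k => (hu k).1 i), fun i s hs hst => ?_⟩
  have hb : Filter.Tendsto (fun k => b i (u k i)) Filter.atTop (nhds (b i (t i))) :=
    ((hbc i).continuousAt (Ici_mem_nhds (hs.trans_lt hst))).tendsto.comp (hui i)
  have hev : ∀ᶠ k in Filter.atTop, s < u k i := (hui i).eventually_const_lt hst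
  have hev2 : ∀ᶠ k in Filter.atTop, ∀ j, t j < t i → u k j < u k i := by
    rw [Filter.eventually_all]
    intro j
    by_cases hj : t j < t i
    · filter_upwards [(hui j).eventually_lt (hui i) hj] with k hk _ using hk
    · exact Filter.Eventually.of_forall (fun y h => absurd h hj)
  refine le_of_tendsto_of_tendsto (((hui i).sub_const s).const_mul (c i))
    ((hb.sub_const (b i s)).mul_const (cN t i)) ?_
  filter_upwards [hev, hev2] with k h1 h2
  refine ((hu k).2 i s hs h1).trans (mul_le_mul_of_nonneg_left ?_ ?_)
  · apply cN_mono
    intro j _ hj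
    by_contra hcon
    exact absurd (h2 j (not_le.1 hcon)) (not_lt.2 hj)
  · exact sub_nonneg.2 (hbm i hs (hs.trans h1.le) h1.le)

lemma setS_bdd {n : ℕ} (b : Fin n → ℝ → ℝ) (c : Fin n → ℝ) (hc : ∀ i, 0 < c i)
    (hbm : ∀ i, MonotoneOn (b i) (Set.Ici 0))
    (hvanish : ∀ i, Filter.Tendsto (fun t : ℝ => b i (t + 1) - b i t)
      Filter.atTop (nhds 0)) :
    ∃ B : Fin n → ℝ, setS b c ⊆ Set.Icc 0 B := by
  have : ∀ i, ∃ B : ℝ, ∀ t ∈ setS b c, t i ≤ B := by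
    intro i
    have hn : (0:ℝ) < 1 + n := by positivity
    have h1 := (hvanish i).eventually_lt_const (div_pos (hc i) hn)
    obtain ⟨B, hB⟩ := Filter.eventually_atTop.1 h1
    refine ⟨max B 0 + 1, fun t ht => ?_⟩
    by_contra hcon
    rw [not_le] at hcon
    have hB0 := le_max_left B 0
    have hB1 := le_max_right B 0
    have h2 := hB (t i - 1) (by linarith)
    have h3 := ht.2 i (t i - 1) (by linarith) (by linarith)
    have h4 : 0 ≤ b i (t i) - b i (t i - 1) := sub_nonneg.2
      (hbm i (Set.mem_Ici.2 (by linarith)) (Set.mem_Ici.2 (by linarith)) (by linarith))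
    have h5 := mul_le_mul_of_nonneg_left (cN_le t i) h4
    rw [sub_add_cancel, lt_div_iff₀ hn] at h2
    linarith
  choose B hB using this
  exact ⟨B, fun t ht => ⟨ht.1, fun i => hB i t ht⟩⟩

lemma setS_R {n : ℕ} (b : Fin n → ℝ → ℝ) (c : Fin n → ℝ)
    (hbc : ∀ i, ContinuousOn (b i) (Set.Ici 0))
    (hbm : ∀ i, MonotoneOn (b i) (Set.Ici 0))
    (hbconc : ∀ i, ConcaveOn ℝ (Set.Ici 0) (b i))
    (t : Fin n → ℝ) (ht : t ∈ setS b c) (hmax : ∀ t' ∈ setS b c, t' ≤ t)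
    (i : Fin n) (s : ℝ) (hs : t i < s) :
    (b i s - b i (t i)) * cM t i ≤ c i * (s - t i) := by
  by_contra hcon
  rw [not_le] at hcon
  have hM := cM_ge_one t i
  have ht0 := ht.1 i
  set g : ℝ → ℝ := fun x => cM t i * b i x - c i * x with hg
  have hgc : ConcaveOn ℝ (Set.Ici 0) g := by
    have h1 : ConcaveOn ℝ (Set.Ici (0:ℝ)) (fun x => cM t i * b i x) :=
      (hbconc i).smul (c := cM t i) (by linarith)
    have h2 : ConvexOn ℝ (Set.Ici (0:ℝ)) (fun x => c i * x) :=
      ((c i) • (LinearMap.id : ℝ →ₗ[ℝ] ℝ)).convexOn (convex_Ici 0)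
    exact h1.sub h2
  have hgs : g (t i) < g s := by simp only [hg]; linarith
  obtain ⟨q, hq1, hqs, hq2⟩ : ∃ q, t i < q ∧ q ≤ s ∧ ∀ j, t i < t j → q ≤ t j := by
    have hev : ∀ᶠ y in nhdsWithin (t i) (Set.Ioi (t i)), t i < y ∧ y ≤ s ∧
        ∀ j, t i < t j → y ≤ t j := by
      refine eventually_mem_nhdsWithin.and (Filter.Eventually.filter_mono nhdsWithin_le_nhds ?_)
      refine ((eventually_lt_nhds hs).mono fun _ h => h.le).and ?_
      rw [Filter.eventually_all]
      intro j
      by_cases hj : t i < t j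
      · filter_upwards [eventually_lt_nhds hj] with y hy _ using hy.le
      · exact Filter.Eventually.of_forall (fun y h => absurd h hj)
    exact hev.exists
  have hgq : g (t i) < g q := by
    rcases hqs.lt_or_eq with h | h
    · have hsl := hgc.slope_anti_adjacent (Set.mem_Ici.2 ht0)
        (Set.mem_Ici.2 (ht0.trans hs.le)) hq1 h
      rw [div_le_div_iff₀ (by linarith) (by linarith)] at hsl
      by_contra hle
      rw [not_lt] at hle
      have h1 : 0 < (g s - g q) * (q - t i) := mul_pos (by linarith) (by linarith)
      have h2 : (g q - g (t i)) * (s - q) ≤ 0 :=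
        mul_nonpos_of_nonpos_of_nonneg (by linarith) (by linarith)
      linarith
    · rw [h]; exact hgs
  have hgcont : ContinuousOn g (Set.Icc (t i) q) := by
    have : ContinuousOn (b i) (Set.Icc (t i) q) := (hbc i).mono fun x hx => ht0.trans hx.1
    fun_prop
  obtain ⟨p, hp, hpm⟩ := isCompact_Icc.exists_isMaxOn (Set.nonempty_Icc.2 hq1.le) hgcont
  have hpq : g q ≤ g p := hpm (Set.right_mem_Icc.2 hq1.le)
  have hpt : t i < p := by
    rcases hp.1.lt_or_eq with h | h
    · exact h
    · rw [← h] at hpq; linarith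
  have hall : ∀ r, 0 ≤ r → r < p → g r ≤ g p := by
    intro r hr hrp
    by_cases h : t i ≤ r
    · exact hpm ⟨h, hrp.le.trans hp.2⟩
    · rw [not_le] at h
      by_contra hlt
      rw [not_le] at hlt
      have hsl := hgc.slope_anti_adjacent (Set.mem_Ici.2 hr)
        (Set.mem_Ici.2 (ht0.trans hpt.le)) h hpt
      rw [div_le_div_iff₀ (by linarith) (by linarith)] at hsl
      have h1 : 0 < (g p - g (t i)) * (t i - r) := mul_pos (by linarith) (by linarith)
      have h2 : (g (t i) - g r) * (p - t i) ≤ 0 :=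
        mul_nonpos_of_nonpos_of_nonneg (by linarith) (by linarith)
      linarith
  have hmem : Function.update t i p ∈ setS b c := by
    refine ⟨fun j => ?_, fun j r hr hrj => ?_⟩
    · by_cases hj : j = i
      · subst hj; rw [Function.update_self]; linarith
      · rw [Function.update_of_ne hj]; exact ht.1 j
    · by_cases hj : j = i
      · subst hj
        rw [Function.update_self] at hrj ⊢
        have h1 := hall r hr hrj
        have h2 : cM t j ≤ cN (Function.update t j p) j := by
          unfold cM cN
          gcongr with k hk
          have hk : k ≠ j := by simpa using hk
          rw [Function.update_self, Function.update_of_ne hk]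
          have := hq2 k
          have hp2 := hp.2
          split_ifs with h3 h4
          · exact le_rfl
          · exact absurd (hp2.trans (this h3)) h4
          · norm_num
          · exact le_rfl
        have h3 : 0 ≤ b j p - b j r := sub_nonneg.2
          (hbm j (Set.mem_Ici.2 hr) (Set.mem_Ici.2 (hr.trans hrj.le)) hrj.le)
        have h4 := mul_le_mul_of_nonneg_left h2 h3
        simp only [hg] at h1
        linarith
      · rw [Function.update_of_ne hj] at hrj ⊢
        refine (ht.2 j r hr hrj).trans (mul_le_mul_of_nonneg_left ?_ ?_)
        · apply cN_mono
          intro k _ hk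
          rw [Function.update_of_ne hj]
          by_cases hki : k = i
          · subst hki; rw [Function.update_self]; linarith
          · rw [Function.update_of_ne hki]; exact hk
        · exact sub_nonneg.2 (hbm j hr (hr.trans hrj.le) hrj.le)
  have := hmax _ hmem i
  rw [Function.update_self] at this
  linarith

/-- Existence of a maximal equilibrium: there is a pure Nash equilibrium `X*` whose
total-data vector componentwise dominates that of every pure Nash equilibrium. -/
theorem exists_maximal_equilibrium (n : ℕ) (hn : 1 ≤ n)
    (b : Fin n → ℝ → ℝ) (c : Fin n → ℝ)
    (hc : ∀ i, 0 < c i)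
    (hbc : ∀ i, ContinuousOn (b i) (Set.Ici 0))
    (hbm : ∀ i, MonotoneOn (b i) (Set.Ici 0))
    (hbconc : ∀ i, ConcaveOn ℝ (Set.Ici 0) (b i))
    (hvanish : ∀ i, Filter.Tendsto (fun t : ℝ => b i (t + 1) - b i t)
      Filter.atTop (nhds 0)) :
    ∃ Xstar : Fin n → ℝ, IsNE b c Xstar ∧
      ∀ X' : Fin n → ℝ, IsNE b c X' → ∀ i, total X' i ≤ total Xstar i := by
  obtain ⟨B, hB⟩ := setS_bdd b c hc hbm hvanish
  have hcomp : IsCompact (setS b c) :=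
    isCompact_Icc.of_isClosed_subset (setS_closed b c hbc hbm) hB
  have hne : (setS b c).Nonempty :=
    ⟨0, fun i => le_rfl, fun i s hs hst => absurd hst (not_lt.2 hs)⟩
  obtain ⟨t, ht, htm⟩ := hcomp.exists_isMaxOn hne
    (f := fun t : Fin n → ℝ => ∑ i, t i) (by fun_prop)
  have hmax : ∀ t' ∈ setS b c, t' ≤ t := by
    intro t' ht' i
    by_contra hlt
    rw [not_le] at hlt
    have h1 : ∑ j, (t ⊔ t') j ≤ ∑ j, t j := htm (setS_sup b c hbm t t' ht ht')
    have h2 : ∑ j, t j < ∑ j, (t ⊔ t') j :=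
      Finset.sum_lt_sum (fun j _ => le_sup_left)
        ⟨i, Finset.mem_univ i, lt_of_lt_of_le hlt le_sup_right⟩
    linarith
  obtain ⟨X, hX0, hX⟩ := exists_total t ht.1
  have hXt : total X = t := funext hX
  refine ⟨X, mem_ne b c hc X hX0 (hXt ▸ ht) ?_, ?_⟩
  · rw [hXt]
    exact setS_R b c hbc hbm hbconc t ht hmax
  · intro X' hX' i
    rw [hXt]
    exact hmax _ (ne_mem b c hbconc X' hX') i
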